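/- arXiv:1611.09376 — 4 statements merged into one kernel-verified Lean document; each statement's English description precedes it below -/
import Mathlib

section
/- Let ω ∈ ⋀^k Ω satisfy the invariance condition ω ∧ df_i ∈ I·⋀^{k+1}Ω for every i = 1,…,k. Then for every strictly increasing multi-index K = (k_1 < ⋯ < k_k) in {1,…,n}, one has Δ_K·ω − a_K·(df_1 ∧ ⋯ ∧ df_k) ∈ I·⋀^k Ω. (This is the algebraic, polynomial-coefficient form of the case q = k of Aleksandrov's decomposition theorem for forms along a complete intersection, which underlies the definition of the GSV-index for Pfaff systems.) -/
open ExteriorAlgebra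

set_option synthInstance.maxHeartbeats 1000000
set_option maxHeartbeats 1000000

noncomputable instance (k n : ℕ) : DecidablePred (fun J : Fin k → Fin n => StrictMono J) :=
  fun _ => Classical.dec _

theorem Matrix.det_of_ite_eq_of_strictMono {R : Type*} [CommRing R] {n k : ℕ} {J K : Fin k → Fin n}
    (hJ : StrictMono J) (hK : StrictMono K) :
    (Matrix.of fun r s => if J r = K s then (1 : R) else 0).det = if J = K then 1 else 0 := by
  split_ifs with h
  · subst h
    rw [← Matrix.det_one (n := Fin k)]
    congr 1
    ext r s
    simp [Matrix.one_apply, hJ.injective.eq_iff]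
  · obtain ⟨r, hr⟩ : ∃ r, ∀ s, J r ≠ K s := by
      by_contra! hc
      refine h ((hJ.range_inj hK).1 (Set.eq_of_subset_of_ncard_le ?_ ?_))
      · rintro _ ⟨r, rfl⟩
        obtain ⟨s, hs⟩ := hc r
        exact ⟨s, hs.symm⟩
      · rw [← Nat.card_coe_set_eq, ← Nat.card_coe_set_eq,
          Nat.card_range_of_injective hJ.injective, Nat.card_range_of_injective hK.injective]
    exact Matrix.det_eq_zero_of_row_eq_zero r fun s => by simp [hr s]

namespace ExteriorAlgebra

open CliffordAlgebra (contractLeft)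

variable {R M : Type*} [CommRing R] [AddCommGroup M] [Module R M]

/-- Successive left contraction by the functionals `v (m - 1)`, …, `v 0`, in this order. -/
def iteratedContractLeft : (m : ℕ) → (Fin m → Module.Dual R M) →
    ExteriorAlgebra R M →ₗ[R] ExteriorAlgebra R M
  | 0, _ => LinearMap.id
  | m + 1, v => contractLeft (v 0) ∘ₗ iteratedContractLeft m (Fin.tail v)

theorem iteratedContractLeft_zero (v : Fin 0 → Module.Dual R M) (x : ExteriorAlgebra R M) :
    iteratedContractLeft 0 v x = x := rfl

theorem iteratedContractLeft_succ {m : ℕ} (v : Fin (m + 1) → Module.Dual R M)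
    (x : ExteriorAlgebra R M) :
    iteratedContractLeft (m + 1) v x =
      contractLeft (v 0) (iteratedContractLeft m (Fin.tail v) x) := rfl

theorem contractLeft_iteratedContractLeft (d : Module.Dual R M) {m : ℕ}
    (v : Fin m → Module.Dual R M) (x : ExteriorAlgebra R M) :
    contractLeft d (iteratedContractLeft m v x) =
      (-1 : R) ^ m • iteratedContractLeft m v (contractLeft d x) := by
  induction m with
  | zero => simp [iteratedContractLeft_zero]
  | succ m ih =>
    rw [iteratedContractLeft_succ, iteratedContractLeft_succ, CliffordAlgebra.contractLeft_comm,
      ih, map_smul, pow_succ, mul_neg_one, neg_smul]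

theorem contractLeft_ιMulti_mul (d : Module.Dual R M) {m : ℕ} (θ : Fin (m + 1) → M)
    (x : ExteriorAlgebra R M) :
    contractLeft d (ιMulti R (m + 1) θ * x) =
      ∑ j : Fin (m + 1), ((-1) ^ (j : ℕ) * d (θ j)) •
          (ιMulti R m (fun i => θ (j.succAbove i)) * x) +
        (-1 : R) ^ (m + 1) • (ιMulti R (m + 1) θ * contractLeft d x) := by
  induction m with
  | zero =>
    simp [ιMulti_succ_apply, CliffordAlgebra.contractLeft_ι_mul, sub_eq_add_neg]
  | succ m ih =>
    rw [ιMulti_succ_apply, mul_assoc, CliffordAlgebra.contractLeft_ι_mul, ih,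
      Fin.sum_univ_succ (n := m + 1)]
    have h (j : Fin (m + 1)) : ιMulti R (m + 1) (fun i => θ (j.succ.succAbove i)) =
        ι R (θ 0) * ιMulti R m (fun i => Matrix.vecTail θ (j.succAbove i)) := by
      rw [ιMulti_succ_apply]
      simp [Matrix.vecTail, Function.comp_def]
    have h0 : ιMulti R (m + 1) (fun i => θ ((0 : Fin (m + 2)).succAbove i)) =
        ιMulti R (m + 1) (Matrix.vecTail θ) := by
      simp [Matrix.vecTail, Function.comp_def]
    have hθ (j : Fin (m + 1)) : Matrix.vecTail θ j = θ j.succ := rfl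
    simp only [h, h0, hθ, mul_add, Finset.mul_sum, mul_smul_comm, mul_assoc, Fin.val_succ,
      pow_succ _ (m + 1), pow_succ _ (Fin.val _), Fin.val_zero, pow_zero, one_mul,
      mul_neg_one, neg_mul, neg_smul, Finset.sum_neg_distrib]
    abel

theorem iteratedContractLeft_ιMulti {m : ℕ} (v : Fin m → Module.Dual R M) (θ : Fin m → M) :
    iteratedContractLeft m v (ιMulti R m θ) =
      ((-1) ^ m.choose 2 * (Matrix.of fun i j => v j (θ i)).det) • 1 := by
  induction m with
  | zero => simp [iteratedContractLeft_zero]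
  | succ m ih =>
    have h := contractLeft_ιMulti_mul (v 0) θ 1
    simp only [mul_one, CliffordAlgebra.contractLeft_one, mul_zero, smul_zero, add_zero] at h
    rw [iteratedContractLeft_succ, contractLeft_iteratedContractLeft, h, map_sum,
      Matrix.det_succ_column_zero, Finset.mul_sum, Finset.sum_smul, Finset.smul_sum]
    refine Finset.sum_congr rfl fun j _ => ?_
    rw [map_smul, ih, smul_smul, smul_smul]
    congr 1
    rw [Nat.choose_succ_succ' m 1, Nat.choose_one_right, pow_add]
    simp only [Matrix.submatrix, Matrix.of_apply, Fin.tail]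
    ring

theorem map_mem_ideal_smul_top {N : Type*} [AddCommGroup N] [Module R N] {P : Type*}
    [AddCommGroup P] [Module R P] (I : Ideal R) (g : N →ₗ[R] P) {x : N}
    (hx : x ∈ I • (⊤ : Submodule R N)) : g x ∈ I • (⊤ : Submodule R P) :=
  Submodule.smul_top_le_comap_smul_top I g hx

/-- If every `θ i ∧ ω` vanishes modulo `I`, then wedging the `θ i` with the iterated contraction
of `ω` recovers, modulo `I`, the multiple of `ω` by the determinant of the pairings. -/
theorem ιMulti_mul_iteratedContractLeft_sub_mem (I : Ideal R) (ω : ExteriorAlgebra R M) {m : ℕ}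
    (v : Fin m → Module.Dual R M) (θ : Fin m → M)
    (h : ∀ i, ι R (θ i) * ω ∈ I • (⊤ : Submodule R (ExteriorAlgebra R M))) :
    ιMulti R m θ * iteratedContractLeft m v ω -
        ((-1) ^ m.choose 2 * (Matrix.of fun i j => v j (θ i)).det) • ω ∈
      I • (⊤ : Submodule R (ExteriorAlgebra R M)) := by
  induction m with
  | zero => simp [iteratedContractLeft_zero]
  | succ m ih =>
    set y := iteratedContractLeft m (Fin.tail v) ω with hy
    have hz : ιMulti R (m + 1) θ * y ∈ I • (⊤ : Submodule R (ExteriorAlgebra R M)) := by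
      have h1 := map_mem_ideal_smul_top I (LinearMap.mulLeft R (ι R (θ 0)))
        (ih (Fin.tail v) (Matrix.vecTail θ) fun i => h i.succ)
      rw [LinearMap.mulLeft_apply, mul_sub, mul_smul_comm, ← mul_assoc, ← ιMulti_succ_apply] at h1
      exact (Submodule.sub_mem_iff_left _ (Submodule.smul_mem _ _ (h 0))).1 h1
    have h2 := map_mem_ideal_smul_top I (contractLeft (v 0)) hz
    rw [contractLeft_ιMulti_mul] at h2
    have h3 := Submodule.sum_mem (I • (⊤ : Submodule R (ExteriorAlgebra R M)))
      (t := Finset.univ) fun (j : Fin (m + 1)) _ => Submodule.smul_mem _ ((-1) ^ (j : ℕ) * v 0 (θ j))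
        (ih (Fin.tail v) (fun i => θ (Fin.succAbove j i)) fun i => h _)
    have h4 := Submodule.smul_mem _ ((-1 : R) ^ (m + 1)) (sub_mem h2 h3)
    rw [iteratedContractLeft_succ, ← hy]
    convert h4 using 1
    simp only [smul_sub, Finset.sum_sub_distrib, ← hy]
    rw [← smul_sub, ← smul_sub, add_sub_sub_cancel, smul_add, smul_smul, ← mul_pow,
      neg_one_mul, neg_neg, one_pow, one_smul, sub_eq_add_neg, ← neg_smul, Finset.smul_sum]
    congr 1
    rw [Matrix.det_succ_column_zero, Finset.mul_sum, ← Finset.sum_neg_distrib, Finset.sum_smul]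
    refine Finset.sum_congr rfl fun j _ => ?_
    rw [smul_smul, smul_smul, Nat.choose_succ_succ' m 1, Nat.choose_one_right]
    congr 1
    simp only [Matrix.submatrix, Matrix.of_apply, Fin.tail]
    ring

theorem ιMulti_mul_ι {m : ℕ} (θ : Fin m → M) (x : M) :
    ιMulti R m θ * ι R x = (-1 : R) ^ m • (ι R x * ιMulti R m θ) := by
  induction m with
  | zero => simp
  | succ m ih =>
    have h : ι R (θ 0) * ι R x = -(ι R x * ι R (θ 0)) :=
      eq_neg_of_add_eq_zero_left (ι_add_mul_swap _ _)
    rw [ιMulti_succ_apply, mul_assoc, ih, mul_smul_comm, ← mul_assoc, h, neg_mul, mul_assoc,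
      pow_succ, mul_neg_one, neg_smul, smul_neg]

theorem mem_ideal_smul_exteriorPower {I : Ideal R} {m : ℕ} {x : ExteriorAlgebra R M}
    (hx : x ∈ ⋀[R]^m M) (h : x ∈ I • (⊤ : Submodule R (ExteriorAlgebra R M))) :
    x ∈ I • ⋀[R]^m M := by
  let p := GradedAlgebra.proj (fun i : ℕ => ⋀[R]^i M) m
  have hp : p x = x := by
    rw [GradedAlgebra.proj_apply, DirectSum.decompose_of_mem_same (fun i : ℕ => ⋀[R]^i M) hx]
  rw [← hp]
  have h1 := Submodule.mem_map_of_mem (f := p) h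
  rw [Submodule.map_smul''] at h1
  refine Submodule.smul_mono le_rfl ?_ h1
  rintro _ ⟨y, -, rfl⟩
  rw [GradedAlgebra.proj_apply]
  exact SetLike.coe_mem _

/-- If `ω` is a `k`-vector with coefficients `a J` and every `ω ∧ θ i` vanishes modulo `I`, then
`ω` and `θ 0 ∧ ⋯ ∧ θ (k - 1)` are proportional modulo `I`. -/
theorem det_smul_sub_smul_ιMulti_mem (I : Ideal R) {n k : ℕ} (e : Fin n → M)
    (v : Fin n → Module.Dual R M) (hev : ∀ i j, v j (e i) = if i = j then 1 else 0)
    (θ : Fin k → M) (a : (Fin k → Fin n) → R) (ω : ExteriorAlgebra R M)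
    (hω : ω = ∑ J ∈ Finset.univ.filter (fun J : Fin k → Fin n => StrictMono J),
      a J • ιMulti R k (fun s => e (J s)))
    (hinv : ∀ i, ω * ι R (θ i) ∈ I • ⋀[R]^(k + 1) M) {K : Fin k → Fin n} (hK : StrictMono K) :
    (Matrix.of fun r s => v (K s) (θ r)).det • ω - a K • ιMulti R k θ ∈ I • ⋀[R]^k M := by
  have hωk : ω ∈ ⋀[R]^k M := by
    rw [hω]
    exact Submodule.sum_mem _ fun J _ => Submodule.smul_mem _ _
      (ιMulti_range R k (Set.mem_range_self _))
  have hcomm (x : M) : ι R x * ω = (-1 : R) ^ k • (ω * ι R x) := by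
    rw [hω, Finset.mul_sum, Finset.sum_mul, Finset.smul_sum]
    refine Finset.sum_congr rfl fun J _ => ?_
    rw [smul_mul_assoc, ιMulti_mul_ι, mul_smul_comm, smul_comm (a J), smul_smul, ← mul_pow]
    simp
  have hθ (i : Fin k) : ι R (θ i) * ω ∈ I • (⊤ : Submodule R (ExteriorAlgebra R M)) := by
    rw [hcomm]
    exact Submodule.smul_mem _ _ (Submodule.smul_mono le_rfl le_top (hinv i))
  have hC : iteratedContractLeft k (fun s => v (K s)) ω = ((-1) ^ k.choose 2 * a K) • 1 := by
    have hJ (J : Fin k → Fin n) (hJ : StrictMono J) :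
        iteratedContractLeft k (fun s => v (K s)) (a J • ιMulti R k (fun s => e (J s))) =
          if J = K then ((-1) ^ k.choose 2 * a K) • 1 else 0 := by
      rw [map_smul, iteratedContractLeft_ιMulti, smul_smul]
      simp only [hev, Matrix.det_of_ite_eq_of_strictMono hJ hK]
      split_ifs with h
      · rw [h, mul_one, mul_comm]
      · simp
    rw [hω, map_sum, Finset.sum_congr rfl fun J h => hJ J (Finset.mem_filter.1 h).2,
      Finset.sum_ite_eq', if_pos (by simpa using hK)]
  have key := ιMulti_mul_iteratedContractLeft_sub_mem I ω (fun s => v (K s)) θ hθ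
  rw [hC, mul_smul_comm, mul_one, mul_smul, mul_smul, ← smul_sub] at key
  have key' := Submodule.smul_mem _ (-(-1 : R) ^ k.choose 2) key
  rw [smul_smul, neg_mul, ← mul_pow, neg_one_mul, neg_neg, one_pow, neg_one_smul, neg_sub] at key'
  exact mem_ideal_smul_exteriorPower (sub_mem (Submodule.smul_mem _ _ hωk)
    (Submodule.smul_mem _ _ (ιMulti_range R k (Set.mem_range_self _)))) key'

end ExteriorAlgebra

theorem stmt0 (n k : ℕ) (hk : 1 ≤ k) (hkn : k ≤ n)
    (f : Fin k → MvPolynomial (Fin n) ℂ)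
    (ω : ExteriorAlgebra (MvPolynomial (Fin n) ℂ) (Ω[MvPolynomial (Fin n) ℂ⁄ℂ]))
    (a : (Fin k → Fin n) → MvPolynomial (Fin n) ℂ)
    (hω : ω = ∑ J ∈ Finset.univ.filter (fun J : Fin k → Fin n => StrictMono J),
      a J • ιMulti (MvPolynomial (Fin n) ℂ) k (fun s => KaehlerDifferential.D ℂ (MvPolynomial (Fin n) ℂ) (MvPolynomial.X (J s))))
    (hinv : ∀ i : Fin k,
      ω * ι (MvPolynomial (Fin n) ℂ) (KaehlerDifferential.D ℂ (MvPolynomial (Fin n) ℂ) (f i)) ∈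
        (Ideal.span (Set.range f)) • (⋀[MvPolynomial (Fin n) ℂ]^(k+1) (Ω[MvPolynomial (Fin n) ℂ⁄ℂ])))
    (K : Fin k → Fin n) (hK : StrictMono K) :
    (Matrix.of fun r s : Fin k => MvPolynomial.pderiv (K s) (f r)).det • ω - a K • ιMulti (MvPolynomial (Fin n) ℂ) k (fun i => KaehlerDifferential.D ℂ (MvPolynomial (Fin n) ℂ) (f i)) ∈
      (Ideal.span (Set.range f)) • (⋀[MvPolynomial (Fin n) ℂ]^k (Ω[MvPolynomial (Fin n) ℂ⁄ℂ])) := by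
  have h := det_smul_sub_smul_ιMulti_mem (Ideal.span (Set.range f))
    (fun i => KaehlerDifferential.D ℂ (MvPolynomial (Fin n) ℂ) (MvPolynomial.X i))
    (fun j => (MvPolynomial.pderiv (R := ℂ) j).liftKaehlerDifferential)
    (fun i j => by
      rw [Derivation.liftKaehlerDifferential_comp_D, MvPolynomial.pderiv_X, Pi.single_apply])
    (fun i => KaehlerDifferential.D ℂ (MvPolynomial (Fin n) ℂ) (f i)) a ω hω hinv hK
  simpa only [Derivation.liftKaehlerDifferential_comp_D] using h
end

section
/- Let ω ∈ ⋀^k Ω satisfy the invariance condition ω ∧ df_i ∈ I·⋀^{k+1}Ω for every i = 1,…,k. Then for every pair of strictly increasing multi-indices J and K of length k in {1,…,n}, one has Δ_K·a_J − Δ_J·a_K ∈ I. (This is the compatibility identity between the coefficients of ω and the maximal Jacobian minors restricted to V, used to prove that the GSV-index can be computed from any single multi-index.) -/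
open ExteriorAlgebra

set_option synthInstance.maxHeartbeats 1000000
set_option maxHeartbeats 1000000

/-- Iterated right contraction of an element of the exterior algebra, in which
`d (Fin.last _)` is contracted first and `d 0` last. -/
noncomputable def iteratedContract {R M : Type*} [CommRing R] [AddCommGroup M] [Module R M] :
    {m : ℕ} → (Fin m → Module.Dual R M) → ExteriorAlgebra R M →ₗ[R] ExteriorAlgebra R M
  | 0, _ => LinearMap.id
  | _ + 1, d =>
    (CliffordAlgebra.contractRight (Q := (0 : QuadraticForm R M))).flip (d 0) ∘ₗ
      iteratedContract (fun i => d i.succ)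

section IteratedContract

variable {R M : Type*} [CommRing R] [AddCommGroup M] [Module R M]

theorem iteratedContract_zero (d : Fin 0 → Module.Dual R M) (x : ExteriorAlgebra R M) :
    iteratedContract d x = x := rfl

theorem iteratedContract_succ {m : ℕ} (d : Fin (m + 1) → Module.Dual R M)
    (x : ExteriorAlgebra R M) :
    iteratedContract d x = CliffordAlgebra.contractRight (Q := (0 : QuadraticForm R M))
      (iteratedContract (fun i => d i.succ) x) (d 0) := rfl

theorem contractRight_mul_ι_exterior (d : Module.Dual R M) (x : ExteriorAlgebra R M) (θ : M) :
    CliffordAlgebra.contractRight (Q := (0 : QuadraticForm R M)) x d * ι R θ =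
      d θ • x - CliffordAlgebra.contractRight (Q := (0 : QuadraticForm R M)) (x * ι R θ) d := by
  rw [eq_sub_iff_add_eq', ← eq_sub_iff_add_eq]
  exact CliffordAlgebra.contractRight_mul_ι d θ x

/-- Leibniz expansion of an iterated contraction against a vector. -/
theorem iteratedContract_mul_ι {m : ℕ} (d : Fin (m + 1) → Module.Dual R M)
    (x : ExteriorAlgebra R M) (θ : M) :
    iteratedContract d x * ι R θ =
      ∑ j : Fin (m + 1), ((-1) ^ (j : ℕ) * d j θ) • iteratedContract (d ∘ j.succAbove) x +
        (-1 : R) ^ (m + 1) • iteratedContract d (x * ι R θ) := by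
  induction m with
  | zero =>
    rw [iteratedContract_succ, contractRight_mul_ι_exterior]
    simp [iteratedContract_succ, iteratedContract_zero, sub_eq_add_neg]
  | succ m ih =>
    have hs (j : Fin (m + 1)) : iteratedContract (d ∘ j.succ.succAbove) x =
        CliffordAlgebra.contractRight (Q := (0 : QuadraticForm R M))
          (iteratedContract ((fun i => d i.succ) ∘ j.succAbove) x) (d 0) := by
      rw [iteratedContract_succ]
      simp [Function.comp_def]
    rw [iteratedContract_succ, contractRight_mul_ι_exterior, Fin.sum_univ_succ,
      ih (fun i => d i.succ), iteratedContract_succ d (x * ι R θ)]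
    simp only [hs, map_add, map_sum, map_smul, LinearMap.add_apply, LinearMap.sum_apply,
      LinearMap.smul_apply, Fin.val_zero, Fin.val_succ, pow_zero, one_mul, pow_succ _ (m + 1),
      pow_succ _ (Fin.val _), mul_neg_one, neg_mul, neg_smul, Finset.sum_neg_distrib,
      Fin.succAbove_zero]
    simp only [Function.comp_def]
    abel

theorem ιMulti_succ_last {m : ℕ} (v : Fin (m + 1) → M) :
    ιMulti R (m + 1) v = ιMulti R m (fun i => v i.castSucc) * ι R (v (Fin.last m)) := by
  simp only [ιMulti_apply, List.ofFn_succ', List.concat_eq_append, List.prod_append,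
    List.prod_singleton]

theorem iteratedContract_ιMulti {m : ℕ} (d : Fin m → Module.Dual R M) (v : Fin m → M) :
    iteratedContract d (ιMulti R m v) =
      algebraMap R _ (Matrix.of fun i j => d j (v i)).det := by
  induction m with
  | zero => simp [iteratedContract_zero]
  | succ m ih =>
    have hzero : iteratedContract d (ιMulti R m fun i => v i.castSucc) = 0 := by
      rw [iteratedContract_succ, ih]
      exact CliffordAlgebra.contractRight_algebraMap _ (d 0) _
    have h := iteratedContract_mul_ι d (ιMulti R m fun i => v i.castSucc) (v (Fin.last m))
    rw [hzero, zero_mul, ← ιMulti_succ_last] at h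
    have h2 : iteratedContract d (ιMulti R (m + 1) v) = (-1 : R) ^ m •
        ∑ j : Fin (m + 1), ((-1) ^ (j : ℕ) * d j (v (Fin.last m))) •
          iteratedContract (d ∘ j.succAbove) (ιMulti R m fun i => v i.castSucc) := by
      rw [eq_neg_of_add_eq_zero_left h.symm, smul_neg, smul_smul, ← pow_add]
      rw [show m + (m + 1) = 2 * m + 1 by ring, pow_succ, pow_mul]
      simp
    rw [h2, Matrix.det_succ_row _ (Fin.last m), map_sum, Finset.smul_sum]
    refine Finset.sum_congr rfl fun j _ => ?_
    rw [ih, smul_smul, Algebra.smul_def, ← map_mul, ← mul_assoc, ← pow_add, Fin.succAbove_last]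
    rfl

variable {I : Ideal R}

theorem Submodule.map_mem_smul_top {N P : Type*} [AddCommGroup N] [Module R N] [AddCommGroup P]
    [Module R P] (g : N →ₗ[R] P) {x : N} (hx : x ∈ I • (⊤ : Submodule R N)) :
    g x ∈ I • (⊤ : Submodule R P) := by
  have := Submodule.mem_map_of_mem (f := g) hx
  rw [Submodule.map_smul''] at this
  exact Submodule.smul_mono le_rfl le_top this

/-- If `ω ∧ θ i` vanishes modulo `I` for all `i`, then so does
`det (d j (θ i)) • ω - (contraction of ω by d) ∧ θ 0 ∧ ⋯ ∧ θ (m - 1)`. -/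
theorem iteratedContract_mul_ιMulti_sub_mem {ω : ExteriorAlgebra R M} {m : ℕ}
    (d : Fin m → Module.Dual R M) (θ : Fin m → M)
    (h : ∀ i, ω * ι R (θ i) ∈ I • (⊤ : Submodule R (ExteriorAlgebra R M))) :
    iteratedContract d ω * ιMulti R m θ - (Matrix.of fun i j => d j (θ i)).det • ω ∈
      I • (⊤ : Submodule R (ExteriorAlgebra R M)) := by
  induction m with
  | zero => simp [iteratedContract_zero]
  | succ m ih =>
    rw [ιMulti_succ_apply, ← mul_assoc, iteratedContract_mul_ι, Matrix.det_succ_row_zero,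
      add_mul, Finset.sum_mul, Finset.sum_smul, add_sub_right_comm, ← Finset.sum_sub_distrib]
    refine add_mem (sum_mem fun j _ => ?_) ?_
    · have hj := Submodule.smul_mem _ ((-1) ^ (j : ℕ) * d j (θ 0))
        (ih (d ∘ j.succAbove) (fun i => θ i.succ) fun i => h i.succ)
      rw [smul_sub, smul_smul] at hj
      rw [smul_mul_assoc]
      exact hj
    · rw [smul_mul_assoc]
      exact Submodule.smul_mem _ _ (Submodule.map_mem_smul_top
        ((LinearMap.mulRight R _) ∘ₗ iteratedContract d) (h 0))

theorem det_mul_sub_det_mul_mem {ω : ExteriorAlgebra R M} {m : ℕ}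
    (d e : Fin m → Module.Dual R M) (θ : Fin m → M)
    (h : ∀ i, ω * ι R (θ i) ∈ I • (⊤ : Submodule R (ExteriorAlgebra R M))) {r s : R}
    (hd : iteratedContract d ω = algebraMap R _ r)
    (he : iteratedContract e ω = algebraMap R _ s) :
    (Matrix.of fun i j => d j (θ i)).det * s - (Matrix.of fun i j => e j (θ i)).det * r ∈ I := by
  have h1 := Submodule.map_mem_smul_top
    ((algebraMapInv : ExteriorAlgebra R M →ₐ[R] R).toLinearMap ∘ₗ iteratedContract e)
    (iteratedContract_mul_ιMulti_sub_mem d θ h)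
  rw [hd, ← Algebra.smul_def] at h1
  simp only [LinearMap.comp_apply, map_sub, map_smul, he, iteratedContract_ιMulti,
    AlgHom.toLinearMap_apply, AlgHom.commutes, smul_eq_mul, Ideal.mul_top] at h1
  rw [← neg_mem_iff]
  convert h1 using 1
  simp
  ring

end IteratedContract

theorem det_coord_basis_of_strictMono {R M : Type*} [CommRing R] [AddCommGroup M] [Module R M]
    {κ : Type*} [LinearOrder κ] {k : ℕ} (b : Module.Basis κ R M) {J K : Fin k → κ}
    (hJ : StrictMono J) (hK : StrictMono K) :
    (Matrix.of fun i j => b.coord (K j) (b (J i))).det = if J = K then 1 else 0 := by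
  split_ifs with h
  · subst h
    rw [← Matrix.det_one (n := Fin k)]
    congr 1
    ext i j
    simp [Matrix.one_apply, Finsupp.single_apply, hJ.injective.eq_iff]
  · by_cases hsub : Set.range J ⊆ Set.range K
    · have : ¬ Set.range K ⊆ Set.range J := fun h' =>
        h ((hJ.range_inj hK).1 (hsub.antisymm h'))
      obtain ⟨_, ⟨j, rfl⟩, hj⟩ := Set.not_subset.1 this
      refine Matrix.det_eq_zero_of_column_eq_zero j fun i => ?_
      have : J i ≠ K j := fun h' => hj ⟨i, h'⟩
      simp [Finsupp.single_apply, this]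
    · obtain ⟨_, ⟨i, rfl⟩, hi⟩ := Set.not_subset.1 hsub
      refine Matrix.det_eq_zero_of_row_eq_zero i fun j => ?_
      have : J i ≠ K j := fun h' => hi ⟨j, h'.symm⟩
      simp [Finsupp.single_apply, this]

theorem stmt1 (n k : ℕ) (hk : 1 ≤ k) (hkn : k ≤ n)
    (f : Fin k → MvPolynomial (Fin n) ℂ)
    (ω : ExteriorAlgebra (MvPolynomial (Fin n) ℂ) (Ω[MvPolynomial (Fin n) ℂ⁄ℂ]))
    (a : (Fin k → Fin n) → MvPolynomial (Fin n) ℂ)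
    (hω : ω = ∑ J ∈ Finset.univ.filter (fun J : Fin k → Fin n => StrictMono J),
      a J • ιMulti (MvPolynomial (Fin n) ℂ) k (fun s => KaehlerDifferential.D ℂ (MvPolynomial (Fin n) ℂ) (MvPolynomial.X (J s))))
    (hinv : ∀ i : Fin k,
      ω * ι (MvPolynomial (Fin n) ℂ) (KaehlerDifferential.D ℂ (MvPolynomial (Fin n) ℂ) (f i)) ∈
        (Ideal.span (Set.range f)) • (⋀[MvPolynomial (Fin n) ℂ]^(k+1) (Ω[MvPolynomial (Fin n) ℂ⁄ℂ])))
    (J K : Fin k → Fin n) (hJ : StrictMono J) (hK : StrictMono K) :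
    (Matrix.of fun r s : Fin k => MvPolynomial.pderiv (K s) (f r)).det * a J - (Matrix.of fun r s : Fin k => MvPolynomial.pderiv (J s) (f r)).det * a K ∈ Ideal.span (Set.range f) := by
  let b := KaehlerDifferential.mvPolynomialBasis ℂ (Fin n)
  have hb (i : Fin n) : KaehlerDifferential.D ℂ (MvPolynomial (Fin n) ℂ) (MvPolynomial.X i) = b i :=
    (KaehlerDifferential.mvPolynomialBasis_apply ℂ _ i).symm
  have hcoord (L : Fin k → Fin n) (hL : StrictMono L) :
      iteratedContract (fun s => b.coord (L s)) ω = algebraMap _ _ (a L) := by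
    simp only [hω, hb, map_sum, map_smul, iteratedContract_ιMulti]
    rw [Finset.sum_eq_single L]
    · rw [det_coord_basis_of_strictMono b hL hL, if_pos rfl, map_one, Algebra.algebraMap_eq_smul_one]
    · intro J' hJ' hne
      rw [det_coord_basis_of_strictMono b (Finset.mem_filter.1 hJ').2 hL, if_neg hne, map_zero,
        smul_zero]
    · intro h
      exact absurd (Finset.mem_filter.2 ⟨Finset.mem_univ _, hL⟩) h
  have h := det_mul_sub_det_mul_mem (fun s => b.coord (K s)) (fun s => b.coord (J s))
    (fun r => KaehlerDifferential.D ℂ (MvPolynomial (Fin n) ℂ) (f r))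
    (fun i => Submodule.smul_mono le_rfl le_top (hinv i)) (hcoord K hK) (hcoord J hJ)
  simpa [b] using h
end

section
/- Let h ∈ R satisfy h·(df_1 ∧ ⋯ ∧ df_k) ∈ I·⋀^k Ω, and suppose that for some strictly increasing multi-index K of length k the image of the Jacobian minor Δ_K in the quotient ring R/I is not a zero divisor. Then h ∈ I. (This is the key cancellation lemma in the proof that the GSV-index of a Pfaff system along an invariant complete intersection is well defined: a function multiplying df_1∧⋯∧df_k into the ideal must itself vanish on V when df_1∧⋯∧df_k does not vanish identically on any irreducible component of V.) -/
open ExteriorAlgebra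

set_option synthInstance.maxHeartbeats 1000000
set_option maxHeartbeats 1000000

/-- The linear form on the exterior algebra extending the alternating map
`v ↦ det (φ s (v r))` attached to a family of linear forms `φ`. -/
noncomputable def detForm {R M : Type*} [CommRing R] [AddCommGroup M] [Module R M] {k : ℕ}
    (φ : Fin k → M →ₗ[R] R) : ExteriorAlgebra R M →ₗ[R] R :=
  liftAlternating (Pi.single k (Matrix.detRowAlternating.compLinearMap (LinearMap.pi φ)))

theorem detForm_ιMulti {R M : Type*} [CommRing R] [AddCommGroup M] [Module R M] {k : ℕ}
    (φ : Fin k → M →ₗ[R] R) (v : Fin k → M) :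
    detForm φ (ιMulti R k v) = (Matrix.of fun r s => φ s (v r)).det := by
  rw [detForm, liftAlternating_apply_ιMulti, Pi.single_eq_same]
  rfl

theorem LinearMap.apply_mem_of_mem_ideal_smul {R M : Type*} [CommRing R] [AddCommGroup M]
    [Module R M] (F : M →ₗ[R] R) {I : Ideal R} {N : Submodule R M} {x : M} (hx : x ∈ I • N) :
    F x ∈ I := by
  refine Submodule.smul_induction_on hx (fun a ha y _ => ?_) fun x y hx hy => ?_
  · simpa using I.mul_mem_right (F y) ha
  · simpa using I.add_mem hx hy

theorem stmt3 (n k : ℕ) (hk : 1 ≤ k) (hkn : k ≤ n)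
    (f : Fin k → MvPolynomial (Fin n) ℂ)
    (h : MvPolynomial (Fin n) ℂ)
    (hh : h • ιMulti (MvPolynomial (Fin n) ℂ) k (fun i => KaehlerDifferential.D ℂ (MvPolynomial (Fin n) ℂ) (f i)) ∈ (Ideal.span (Set.range f)) • (⋀[MvPolynomial (Fin n) ℂ]^k (Ω[MvPolynomial (Fin n) ℂ⁄ℂ])))
    (K : Fin k → Fin n) (hK : StrictMono K)
    (hreg : Ideal.Quotient.mk (Ideal.span (Set.range f)) ((Matrix.of fun r s : Fin k => MvPolynomial.pderiv (K s) (f r)).det) ∈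
      nonZeroDivisors (MvPolynomial (Fin n) ℂ ⧸ Ideal.span (Set.range f))) :
    h ∈ Ideal.span (Set.range f) := by
  have key := LinearMap.apply_mem_of_mem_ideal_smul
    (detForm fun s => (MvPolynomial.pderiv (R := ℂ) (K s)).liftKaehlerDifferential) hh
  rw [map_smul, detForm_ιMulti, smul_eq_mul] at key
  simp only [Derivation.liftKaehlerDifferential_comp_D] at key
  rw [← Ideal.Quotient.eq_zero_iff_mem, map_mul] at key
  exact Ideal.Quotient.eq_zero_iff_mem.mp
    ((mul_right_mem_nonZeroDivisors_eq_zero_iff hreg).mp key)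
end

section
/- Let ω ∈ ⋀^k Ω satisfy the invariance condition ω ∧ df_i ∈ I·⋀^{k+1}Ω for every i = 1,…,k. For any family of polynomials (λ_K)_K indexed by the strictly increasing multi-indices K of length k, set g := Σ_K λ_K·Δ_K and ξ := Σ_K λ_K·a_K. Then for every strictly increasing multi-index J of length k, g·a_J − ξ·Δ_J ∈ I. (This identity, ξ·Δ_J = g·a_J on V, is the heart of the formula GSV(ω,V,S) = ord_S(a_J|_V) − ord_S(Δ_J|_V) expressing the GSV-index of ω along V through any single coefficient and the corresponding Jacobian minor.) -/
open ExteriorAlgebra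

set_option synthInstance.maxHeartbeats 1000000
set_option maxHeartbeats 1000000

namespace ExteriorAlgebra

variable {R M : Type*} [CommRing R] [AddCommGroup M] [Module R M]

/-- Contract on the right by `v (m - 1)`, then by `v (m - 2)`, and so on down to `v 0`. -/
noncomputable def iteratedContractRight :
    (m : ℕ) → (Fin m → Module.Dual R M) → ExteriorAlgebra R M →ₗ[R] ExteriorAlgebra R M
  | 0, _ => LinearMap.id
  | m + 1, v =>
    (CliffordAlgebra.contractRight (Q := (0 : QuadraticForm R M))).flip (v 0) ∘ₗ
      iteratedContractRight m (Fin.tail v)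

@[simp]
theorem iteratedContractRight_zero (v : Fin 0 → Module.Dual R M) (x : ExteriorAlgebra R M) :
    iteratedContractRight 0 v x = x :=
  rfl

theorem iteratedContractRight_succ {m : ℕ} (v : Fin (m + 1) → Module.Dual R M)
    (x : ExteriorAlgebra R M) :
    iteratedContractRight (m + 1) v x =
      (CliffordAlgebra.contractRight (Q := (0 : QuadraticForm R M))).flip (v 0)
        (iteratedContractRight m (Fin.tail v) x) :=
  rfl

theorem contractRight_flip_mul_ι (d : Module.Dual R M) (a : M) (x : ExteriorAlgebra R M) :
    (CliffordAlgebra.contractRight (Q := (0 : QuadraticForm R M))).flip d x * ι R a =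
      d a • x - (CliffordAlgebra.contractRight (Q := (0 : QuadraticForm R M))).flip d (x * ι R a) :=
  eq_sub_of_add_eq' (eq_sub_iff_add_eq.1 (CliffordAlgebra.contractRight_mul_ι d a x))

theorem iteratedContractRight_mul_ι {m : ℕ} (v : Fin (m + 1) → Module.Dual R M) (a : M)
    (x : ExteriorAlgebra R M) :
    iteratedContractRight (m + 1) v x * ι R a =
      ∑ j : Fin (m + 1), ((-1) ^ (j : ℕ) * v j a) •
          iteratedContractRight m (fun i => v (j.succAbove i)) x +
        (-1 : R) ^ (m + 1) • iteratedContractRight (m + 1) v (x * ι R a) := by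
  induction m with
  | zero =>
    rw [iteratedContractRight_succ, contractRight_flip_mul_ι, iteratedContractRight_succ]
    simp [sub_eq_add_neg]
  | succ m ih =>
    rw [iteratedContractRight_succ, contractRight_flip_mul_ι, ih, map_add, map_sum, map_smul,
      ← iteratedContractRight_succ, Fin.sum_univ_succ (n := m + 1), sub_add_eq_sub_sub,
      sub_eq_add_neg, sub_eq_add_neg, ← Finset.sum_neg_distrib]
    congr 1
    · congr 1
      · simp [Fin.tail_def]
      · refine Finset.sum_congr rfl fun j _ => ?_
        rw [map_smul, ← neg_smul, iteratedContractRight_succ]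
        simp [Fin.tail_def, pow_succ]
    · rw [← neg_smul, pow_succ (-1 : R) (m + 1)]
      simp

theorem ιMulti_succ_apply_last {m : ℕ} (θ : Fin (m + 1) → M) :
    ιMulti R (m + 1) θ =
      ιMulti R m (fun i => θ i.castSucc) * ι R (θ (Fin.last m)) := by
  simp only [ιMulti_apply, List.ofFn_succ', List.concat_eq_append, List.prod_append,
    List.prod_singleton]

theorem iteratedContractRight_ιMulti {m : ℕ} (v : Fin m → Module.Dual R M) (θ : Fin m → M) :
    iteratedContractRight m v (ιMulti R m θ) =
      algebraMap R _ (Matrix.of fun r s => v s (θ r)).det := by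
  induction m with
  | zero => simp
  | succ m ih =>
    have h := iteratedContractRight_mul_ι v (θ (Fin.last m)) (ιMulti R m fun i => θ i.castSucc)
    have hz : iteratedContractRight (m + 1) v (ιMulti R m fun i => θ i.castSucc) = 0 := by
      rw [iteratedContractRight_succ, ih]
      exact CliffordAlgebra.contractRight_algebraMap _ _ _
    rw [← ιMulti_succ_apply_last, hz, zero_mul] at h
    have hs : ((-1 : R) ^ (m + 1)) * (-1) ^ (m + 1) = 1 := by
      rw [← mul_pow]; simp
    rw [← one_smul R (iteratedContractRight _ _ _), ← hs, mul_smul,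
      eq_neg_of_add_eq_zero_right h.symm, Matrix.det_succ_row _ (Fin.last m), map_sum,
      ← Finset.sum_neg_distrib, Finset.smul_sum]
    refine Finset.sum_congr rfl fun j _ => ?_
    rw [ih, ← neg_smul, smul_smul, Algebra.smul_def, ← map_mul]
    congr 2
    · simp [pow_add, mul_assoc]
    · simp [Matrix.submatrix]

/-- A form whose wedge with each `θ i` vanishes modulo `I` becomes, when scaled by the
determinant of the pairing with `v`, a multiple of the product of the `θ i` modulo `I`. -/
theorem iteratedContractRight_mul_ιMulti_sub_mem {I : Ideal R} {m : ℕ}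
    (v : Fin m → Module.Dual R M) (θ : Fin m → M) {x : ExteriorAlgebra R M}
    (hx : ∀ i, x * ι R (θ i) ∈ I • (⊤ : Submodule R (ExteriorAlgebra R M))) :
    iteratedContractRight m v x * ιMulti R m θ - (Matrix.of fun r s => v s (θ r)).det • x ∈
      I • (⊤ : Submodule R (ExteriorAlgebra R M)) := by
  have map_mem (g : ExteriorAlgebra R M →ₗ[R] ExteriorAlgebra R M) {y}
      (hy : y ∈ I • (⊤ : Submodule R (ExteriorAlgebra R M))) : g y ∈ I • (⊤ : Submodule R _) :=
    Submodule.smul_mono le_rfl le_top (Submodule.map_smul'' I ⊤ g ▸ Submodule.mem_map_of_mem hy)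
  induction m with
  | zero => simp
  | succ m ih =>
    rw [ιMulti_succ_apply, ← mul_assoc, iteratedContractRight_mul_ι, Matrix.det_succ_row_zero,
      add_mul, Finset.sum_mul, Finset.sum_smul, add_sub_right_comm, ← Finset.sum_sub_distrib]
    refine add_mem (sum_mem fun j _ => ?_) ?_
    · rw [smul_mul_assoc, Matrix.of_apply, mul_smul _ (Matrix.det _), ← smul_sub]
      exact Submodule.smul_mem _ _ (ih (fun i => v (j.succAbove i)) (Matrix.vecTail θ)
        fun i => hx i.succ)
    · exact map_mem (LinearMap.mulRight R _)
        (Submodule.smul_mem _ _ (map_mem (iteratedContractRight (m + 1) v) (hx 0)))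

end ExteriorAlgebra

theorem Matrix.det_single_strictMono {R α : Type*} [CommRing R] [LinearOrder α] {k : ℕ}
    {J K : Fin k → α} (hJ : StrictMono J) (hK : StrictMono K) :
    (Matrix.of fun r s => Finsupp.single (J r) (1 : R) (K s)).det = if J = K then 1 else 0 := by
  split_ifs with h
  · subst h
    convert Matrix.det_one (n := Fin k) (R := R)
    ext r s
    simp [Finsupp.single_apply, Matrix.one_apply, hJ.injective.eq_iff]
  · obtain ⟨r, hr⟩ : ∃ r, J r ∉ Set.range K := by
      by_contra! hsub
      refine h ((hJ.range_inj hK).1 ?_)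
      have hle : Finset.univ.image J ⊆ Finset.univ.image K := by
        simpa [Finset.subset_iff] using hsub
      have := Finset.eq_of_subset_of_card_le hle (by
        simp [Finset.card_image_of_injective _ hJ.injective,
          Finset.card_image_of_injective _ hK.injective])
      simpa using congrArg (fun s : Finset α => (s : Set α)) this
    refine Matrix.det_eq_zero_of_row_eq_zero r fun s => ?_
    exact Finsupp.single_eq_of_ne fun e => hr ⟨s, e⟩

theorem stmt5 (n k : ℕ) (hk : 1 ≤ k) (hkn : k ≤ n)
    (f : Fin k → MvPolynomial (Fin n) ℂ)
    (ω : ExteriorAlgebra (MvPolynomial (Fin n) ℂ) (Ω[MvPolynomial (Fin n) ℂ⁄ℂ]))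
    (a : (Fin k → Fin n) → MvPolynomial (Fin n) ℂ)
    (hω : ω = ∑ J ∈ Finset.univ.filter (fun J : Fin k → Fin n => StrictMono J),
      a J • ιMulti (MvPolynomial (Fin n) ℂ) k (fun s => KaehlerDifferential.D ℂ (MvPolynomial (Fin n) ℂ) (MvPolynomial.X (J s))))
    (hinv : ∀ i : Fin k,
      ω * ι (MvPolynomial (Fin n) ℂ) (KaehlerDifferential.D ℂ (MvPolynomial (Fin n) ℂ) (f i)) ∈
        (Ideal.span (Set.range f)) • (⋀[MvPolynomial (Fin n) ℂ]^(k+1) (Ω[MvPolynomial (Fin n) ℂ⁄ℂ])))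
    (lam : (Fin k → Fin n) → MvPolynomial (Fin n) ℂ)
    (J : Fin k → Fin n) (hJ : StrictMono J) :
    (∑ K ∈ Finset.univ.filter (fun K : Fin k → Fin n => StrictMono K), lam K * (Matrix.of fun r s : Fin k => MvPolynomial.pderiv (K s) (f r)).det) * a J - (∑ K ∈ Finset.univ.filter (fun K : Fin k → Fin n => StrictMono K), lam K * a K) * (Matrix.of fun r s : Fin k => MvPolynomial.pderiv (J s) (f r)).det ∈ Ideal.span (Set.range f) := by
  have coeff : ∀ K : Fin k → Fin n, StrictMono K →
      iteratedContractRight k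
          (fun s => (KaehlerDifferential.mvPolynomialBasis ℂ (Fin n)).coord (K s)) ω =
        algebraMap _ _ (a K) := by
    intro K hK
    rw [hω, map_sum, Finset.sum_eq_single_of_mem K (by simpa using hK)]
    · rw [map_smul, iteratedContractRight_ιMulti]
      simp [Matrix.det_single_strictMono hK hK, Algebra.smul_def]
    · intro L hL hne
      rw [map_smul, iteratedContractRight_ιMulti]
      simp [Matrix.det_single_strictMono (Finset.mem_filter.1 hL).2 hK, hne]
  have key : ∀ K : Fin k → Fin n, StrictMono K →
      a K * (Matrix.of fun r s : Fin k => MvPolynomial.pderiv (J s) (f r)).det -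
        (Matrix.of fun r s : Fin k => MvPolynomial.pderiv (K s) (f r)).det * a J ∈
        Ideal.span (Set.range f) := by
    intro K hK
    have h := iteratedContractRight_mul_ιMulti_sub_mem
      (fun s => (KaehlerDifferential.mvPolynomialBasis ℂ (Fin n)).coord (K s)) _
      fun i => Submodule.smul_mono le_rfl le_top (hinv i)
    have h' := Submodule.mem_map_of_mem
      (f := (algebraMapInv (R := MvPolynomial (Fin n) ℂ)).toLinearMap ∘ₗ iteratedContractRight k
        (fun s => (KaehlerDifferential.mvPolynomialBasis ℂ (Fin n)).coord (J s))) h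
    rw [Submodule.map_smul''] at h'
    replace h' := Submodule.smul_mono le_rfl le_top h'
    rw [coeff K hK, ← Algebra.smul_def, map_sub, map_smul, map_smul, LinearMap.comp_apply,
      LinearMap.comp_apply, coeff J hJ, iteratedContractRight_ιMulti] at h'
    simpa [algebraMap_leftInverse _ _, Module.Basis.coord_apply] using h'
  rw [Finset.sum_mul, Finset.sum_mul, ← Finset.sum_sub_distrib]
  refine sum_mem fun K hK => ?_
  convert Ideal.mul_mem_left _ (-lam K) (key K (Finset.mem_filter.1 hK).2) using 1
  ring
end
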